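/- arXiv:2510.13275 — 2 statements merged into one kernel-verified Lean document; each statement's English description precedes it below -/
import Mathlib

section
/- For every cutoff ζ and every λ > 1, lim_{ε→0⁺} ∫_{−δ_ε}^{δ_ε} (ε/2)·q_ε'(t)² dt = c₀/2 and lim_{ε→0⁺} ∫_{−δ_ε}^{δ_ε} (1/ε)·W(q_ε(t)) dt = c₀/2. -/
open MeasureTheory Filter Set intervalIntegral Topology

/-- The double-well potential `W(z) = (1 - z²)²`. -/
noncomputable def Wpot (z : ℝ) : ℝ := (1 - z ^ 2) ^ 2

/-- Its derivative `W'(z) = -4z(1 - z²)`. -/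
noncomputable def Wpot' (z : ℝ) : ℝ := -4 * z * (1 - z ^ 2)

/-- The constant `c₀ = ∫_{-1}^1 √(2W) = 4√2/3`. -/
noncomputable def cZero : ℝ := 4 * Real.sqrt 2 / 3

/-- The optimal profile `q(t) = tanh(√2 t)`. -/
noncomputable def qprof (t : ℝ) : ℝ := Real.tanh (Real.sqrt 2 * t)

/-- A cutoff function: smooth, compactly supported, valued in `[0,1]`,
equal to `1` on `{ |t| ≤ 1 }` and to `0` on `{ |t| ≥ 2 }`. -/
def IsCutoff (ζ : ℝ → ℝ) : Prop :=
  ContDiff ℝ (⊤ : ℕ∞) ζ ∧ HasCompactSupport ζ ∧ (∀ t, ζ t ∈ Set.Icc (0:ℝ) 1) ∧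
    (∀ t, |t| ≤ 1 → ζ t = 1) ∧ (∀ t, 2 ≤ |t| → ζ t = 0)

/-- `δ_ε = λ ε |log ε|`. -/
noncomputable def deltaE (lam ε : ℝ) : ℝ := lam * ε * |Real.log ε|

/-- The truncated optimal profile
`q_ε(t) = ζ(2t/δ_ε) q(t/ε) + sign(t) (1 - ζ(2t/δ_ε))`. -/
noncomputable def qE (ζ : ℝ → ℝ) (lam ε t : ℝ) : ℝ :=
  ζ (2 * t / deltaE lam ε) * qprof (t / ε) + Real.sign t * (1 - ζ (2 * t / deltaE lam ε))


theorem qprof_sq_le_one (s : ℝ) : qprof s ^ 2 ≤ 1 := (Real.tanh_sq_lt_one _).le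

theorem qprof_neg (s : ℝ) : qprof (-s) = -qprof s := by
  simp [qprof, Real.tanh_neg]

theorem hasDerivAt_qprof (s : ℝ) :
    HasDerivAt qprof (Real.sqrt 2 * (1 - qprof s ^ 2)) s := by
  have hlin : HasDerivAt (fun s : ℝ => Real.sqrt 2 * s) (Real.sqrt 2) s := by
    simpa using (hasDerivAt_id s).const_mul (Real.sqrt 2)
  have hc := (Real.cosh_pos (Real.sqrt 2 * s)).ne'
  have h := hlin.sinh.fun_div hlin.cosh hc
  have hfun : qprof = fun s => Real.sinh (Real.sqrt 2 * s) / Real.cosh (Real.sqrt 2 * s) := by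
    funext s
    rw [qprof, Real.tanh_eq_sinh_div_cosh]
  rw [hfun]
  refine h.congr_deriv ?_
  field_simp

theorem continuous_qprof : Continuous qprof :=
  continuous_iff_continuousAt.2 fun s => (hasDerivAt_qprof s).continuousAt

theorem tendsto_tanh_atTop : Tendsto Real.tanh atTop (𝓝 1) := by
  have hexp : Tendsto (fun x : ℝ => Real.exp (-(2 * x))) atTop (𝓝 0) :=
    Real.tendsto_exp_neg_atTop_nhds_zero.comp (tendsto_id.const_mul_atTop two_pos)
  have h : Tendsto (fun x : ℝ => (1 - Real.exp (-(2 * x))) / (1 + Real.exp (-(2 * x))))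
      atTop (𝓝 ((1 - 0) / (1 + 0))) :=
    (hexp.const_sub 1).div (hexp.const_add 1) (by norm_num)
  have hfun : Real.tanh =
      fun x : ℝ => (1 - Real.exp (-(2 * x))) / (1 + Real.exp (-(2 * x))) := by
    funext x
    have hx : Real.exp (-(2 * x)) = Real.exp (-x) * Real.exp (-x) := by
      rw [← Real.exp_add]
      ring_nf
    have hinv : Real.exp x * Real.exp (-x) = 1 := by rw [← Real.exp_add]; simp
    have h1 := Real.exp_pos x
    have h2 := Real.exp_pos (-x)
    rw [Real.tanh_eq, hx, div_eq_div_iff (by positivity) (by positivity)]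
    linear_combination (2 * Real.exp (-x)) * hinv
  rw [hfun]
  simpa using h

theorem tendsto_qprof_atTop : Tendsto qprof atTop (𝓝 1) :=
  tendsto_tanh_atTop.comp (tendsto_id.const_mul_atTop (by positivity))

/-- The antiderivative `(q - q³/3)/√2` of `W ∘ q`. -/
theorem hasDerivAt_primitive (s : ℝ) :
    HasDerivAt (fun s => (qprof s - qprof s ^ 3 / 3) / Real.sqrt 2) (Wpot (qprof s)) s := by
  have hq := hasDerivAt_qprof s
  have h := (hq.sub ((hq.pow 3).div_const 3)).div_const (Real.sqrt 2)
  refine h.congr_deriv ?_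
  have h2 : Real.sqrt 2 ≠ 0 := by positivity
  simp only [Wpot]
  field_simp
  push_cast
  ring

theorem continuous_Wpot_qprof : Continuous fun s => Wpot (qprof s) := by
  unfold Wpot
  have := continuous_qprof
  fun_prop

theorem Wpot_nonneg (z : ℝ) : 0 ≤ Wpot z := sq_nonneg _

theorem tendsto_intervalIntegral_Wpot_qprof :
    Tendsto (fun L : ℝ => ∫ s in (-L)..L, Wpot (qprof s)) atTop (𝓝 (cZero / 2)) := by
  have heq : ∀ L : ℝ, ∫ s in (-L)..L, Wpot (qprof s) =
      2 * ((qprof L - qprof L ^ 3 / 3) / Real.sqrt 2) := by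
    intro L
    rw [integral_eq_sub_of_hasDerivAt (fun s _ => hasDerivAt_primitive s)
      (continuous_Wpot_qprof.intervalIntegrable _ _), qprof_neg]
    ring
  simp only [heq]
  have h := ((tendsto_qprof_atTop.sub
    ((tendsto_qprof_atTop.pow 3).div_const 3)).div_const (Real.sqrt 2)).const_mul 2
  convert h using 2
  have h2 : Real.sqrt 2 ≠ 0 := by positivity
  have hs : Real.sqrt 2 ^ 2 = 2 := Real.sq_sqrt (by norm_num)
  rw [cZero]
  field_simp
  rw [hs]
  norm_num

theorem integrable_Wpot_qprof : Integrable fun s => Wpot (qprof s) := by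
  refine integrable_of_intervalIntegral_norm_tendsto (l := atTop) (a := fun L : ℝ => -L)
    (b := fun L => L) (cZero / 2) (fun L => continuous_Wpot_qprof.integrableOn_Ioc)
    tendsto_neg_atTop_atBot tendsto_id ?_
  simpa only [Real.norm_of_nonneg (Wpot_nonneg _)] using tendsto_intervalIntegral_Wpot_qprof

theorem integral_Wpot_qprof : ∫ s, Wpot (qprof s) = cZero / 2 :=
  tendsto_nhds_unique
    (intervalIntegral_tendsto_integral integrable_Wpot_qprof tendsto_neg_atTop_atBot tendsto_id)
    tendsto_intervalIntegral_Wpot_qprof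

/-- Dominated convergence on the growing intervals `[-L, L]`. -/
theorem tendsto_intervalIntegral_neg_self_of_dominated {F : ℝ → ℝ → ℝ} {f bound : ℝ → ℝ}
    (hF : ∀ L, Measurable (F L)) (hbound : Integrable bound)
    (hle : ∀ᶠ L in atTop, ∀ᵐ s, ‖F L s‖ ≤ bound s)
    (hlim : ∀ s, ∀ᶠ L in atTop, F L s = f s) :
    Tendsto (fun L : ℝ => ∫ s in (-L)..L, F L s) atTop (𝓝 (∫ s, f s)) := by
  have h : Tendsto (fun L : ℝ => ∫ s, (Ioc (-L) L).indicator (F L) s) atTop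
      (𝓝 (∫ s, f s)) := by
    refine tendsto_integral_filter_of_dominated_convergence bound
      (Eventually.of_forall fun L =>
        ((hF L).indicator measurableSet_Ioc).aestronglyMeasurable) ?_ hbound
      (Eventually.of_forall fun s => ?_)
    · filter_upwards [hle] with L hL
      filter_upwards [hL] with s hs
      exact (norm_indicator_le_norm_self _ _).trans hs
    · refine tendsto_const_nhds.congr' ?_
      filter_upwards [hlim s, eventually_gt_atTop |s|] with L hL hsL
      rw [indicator_of_mem (mem_Ioc.2 ⟨(abs_lt.1 hsL).1, (abs_lt.1 hsL).2.le⟩), hL]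
  refine h.congr' ?_
  filter_upwards [eventually_ge_atTop 0] with L hL
  rw [integral_of_le (by linarith), MeasureTheory.integral_indicator measurableSet_Ioc]

/-- The truncated profile in the rescaled variable `s = t/ε`, with `L = δ_ε/ε`. -/
noncomputable def truncatedProfile (ζ : ℝ → ℝ) (L s : ℝ) : ℝ :=
  ζ (2 * s / L) * qprof s + Real.sign s * (1 - ζ (2 * s / L))

theorem sign_div_of_pos {ε : ℝ} (hε : 0 < ε) (t : ℝ) : Real.sign (t / ε) = Real.sign t := by
  rcases lt_trichotomy t 0 with h | rfl | h
  · rw [Real.sign_of_neg h, Real.sign_of_neg (div_neg_of_neg_of_pos h hε)]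
  · simp
  · rw [Real.sign_of_pos h, Real.sign_of_pos (div_pos h hε)]

theorem measurable_real_sign : Measurable Real.sign := by
  have h : Real.sign = fun r : ℝ => if r < 0 then (-1 : ℝ) else if 0 < r then 1 else 0 := by
    funext r
    rfl
  rw [h]
  exact Measurable.ite measurableSet_Iio measurable_const
    (Measurable.ite measurableSet_Ioi measurable_const measurable_const)

theorem qE_eq_truncatedProfile (ζ : ℝ → ℝ) (lam : ℝ) {ε : ℝ} (hε : 0 < ε) (t : ℝ) :
    qE ζ lam ε t = truncatedProfile ζ (lam * |Real.log ε|) (t / ε) := by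
  have h : 2 * (t / ε) / (lam * |Real.log ε|) = 2 * t / deltaE lam ε := by
    rw [← mul_div_assoc, div_div, deltaE]
    ring_nf
  rw [qE, truncatedProfile, h, sign_div_of_pos hε]

theorem sign_mul_qprof_nonneg (s : ℝ) : 0 ≤ Real.sign s * qprof s := by
  have hpos : ∀ s : ℝ, 0 < s → 0 ≤ qprof s := fun s hs => by
    rw [qprof, Real.tanh_eq_sinh_div_cosh]
    exact div_nonneg (Real.sinh_nonneg_iff.2 (by positivity)) (Real.cosh_pos _).le
  rcases lt_trichotomy s 0 with h | rfl | h
  · have := hpos (-s) (by linarith)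
    rw [qprof_neg] at this
    rw [Real.sign_of_neg h]
    linarith
  · simp
  · rw [Real.sign_of_pos h, one_mul]
    exact hpos s h

theorem sign_sq {s : ℝ} (hs : s ≠ 0) : Real.sign s ^ 2 = 1 := by
  rcases Real.sign_apply_eq_of_ne_zero s hs with h | h <;> simp [h]

theorem sign_mul_qprof_le_one (s : ℝ) : Real.sign s * qprof s ≤ 1 := by
  have hq : |qprof s| ≤ 1 := (Real.abs_tanh_lt_one _).le
  rw [abs_le] at hq
  rcases Real.sign_apply_eq s with h | h | h <;> rw [h] <;> linarith [hq.1, hq.2]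

theorem abs_qprof_sub_sign_le {s : ℝ} (hs : s ≠ 0) :
    |qprof s - Real.sign s| ≤ 1 - qprof s ^ 2 := by
  have h0 := sign_mul_qprof_nonneg s
  have h1 := sign_mul_qprof_le_one s
  rw [abs_le]
  rcases Real.sign_apply_eq_of_ne_zero s hs with h | h <;> rw [h] at h0 h1 ⊢ <;>
    constructor <;> nlinarith

theorem Wpot_truncatedProfile_le {ζ : ℝ → ℝ} (hζ : IsCutoff ζ) (L : ℝ) {s : ℝ} (hs : s ≠ 0) :
    Wpot (truncatedProfile ζ L s) ≤ Wpot (qprof s) := by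
  obtain ⟨z0, z1⟩ := hζ.2.2.1 (2 * s / L)
  have h0 := sign_mul_qprof_nonneg s
  have h1 := sign_mul_qprof_le_one s
  have hsq := sign_sq hs
  unfold truncatedProfile Wpot
  set z := ζ (2 * s / L)
  set σ := Real.sign s
  set r := σ * qprof s with hr
  have hqr : qprof s ^ 2 = r ^ 2 := by rw [hr, mul_pow, hsq, one_mul]
  have hp : (z * qprof s + σ * (1 - z)) ^ 2 = (z * r + (1 - z)) ^ 2 := by
    rw [hr]
    linear_combination ((1 - z) ^ 2 - z ^ 2 * qprof s ^ 2) * hsq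
  have hpr : r ≤ z * r + (1 - z) := by nlinarith
  have hp1 : z * r + (1 - z) ≤ 1 := by nlinarith
  rw [hp, hqr]
  exact pow_le_pow_left₀ (by nlinarith) (by nlinarith) 2

theorem hasDerivAt_truncatedProfile {ζ : ℝ → ℝ} (hζ : Differentiable ℝ ζ) (L : ℝ) {s : ℝ}
    (hs : s ≠ 0) :
    HasDerivAt (truncatedProfile ζ L)
      (ζ (2 * s / L) * (Real.sqrt 2 * (1 - qprof s ^ 2)) +
        deriv ζ (2 * s / L) * (2 / L) * (qprof s - Real.sign s)) s := by
  have hlin : HasDerivAt (fun s : ℝ => 2 * s / L) (2 / L) s := by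
    simpa using ((hasDerivAt_id s).const_mul 2).div_const L
  have hz : HasDerivAt (fun s => ζ (2 * s / L)) (deriv ζ (2 * s / L) * (2 / L)) s :=
    (hζ _).hasDerivAt.comp s hlin
  have hsign : Real.sign =ᶠ[𝓝 s] fun _ => Real.sign s := by
    rcases hs.lt_or_gt with h | h
    · filter_upwards [Iio_mem_nhds h] with x hx
      rw [Real.sign_of_neg hx, Real.sign_of_neg h]
    · filter_upwards [Ioi_mem_nhds h] with x hx
      rw [Real.sign_of_pos hx, Real.sign_of_pos h]
  have h := (hz.mul (hasDerivAt_qprof s)).add ((hz.const_sub 1).const_mul (Real.sign s))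
  refine (h.congr_deriv (by ring)).congr_of_eventuallyEq ?_
  filter_upwards [hsign] with x hx
  simp [truncatedProfile, hx]

theorem truncatedProfile_eq_qprof {ζ : ℝ → ℝ} (hζ : IsCutoff ζ) {L s : ℝ} (h : 2 * |s| < L) :
    truncatedProfile ζ L s = qprof s := by
  have hL : 0 < L := by linarith [abs_nonneg s]
  have hz : ζ (2 * s / L) = 1 := by
    apply hζ.2.2.2.1
    rw [abs_div, abs_mul, abs_two, abs_of_pos hL, div_le_one hL]
    exact h.le
  simp [truncatedProfile, hz]

theorem deriv_truncatedProfile_eq {ζ : ℝ → ℝ} (hζ : IsCutoff ζ) {L s : ℝ} (h : 2 * |s| < L) :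
    deriv (truncatedProfile ζ L) s = Real.sqrt 2 * (1 - qprof s ^ 2) := by
  have heq : truncatedProfile ζ L =ᶠ[𝓝 s] qprof := by
    have hc : Continuous fun x : ℝ => 2 * |x| := by fun_prop
    filter_upwards [hc.continuousAt.eventually_lt continuousAt_const h] with x hx
    exact truncatedProfile_eq_qprof hζ hx
  rw [heq.deriv_eq, (hasDerivAt_qprof s).deriv]

theorem measurable_truncatedProfile {ζ : ℝ → ℝ} (hζ : Continuous ζ) (L : ℝ) :
    Measurable (truncatedProfile ζ L) := by
  have hz : Measurable fun s => ζ (2 * s / L) := by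
    have : Continuous fun s : ℝ => 2 * s / L := by fun_prop
    exact (hζ.comp this).measurable
  exact (hz.mul continuous_qprof.measurable).add
    (measurable_real_sign.mul (measurable_const.sub hz))

theorem half_sq_deriv_truncatedProfile_le {ζ : ℝ → ℝ} (hζ : IsCutoff ζ) {C : ℝ}
    (hC : ∀ x, ‖deriv ζ x‖ ≤ C) {L s : ℝ} (hL : 2 ≤ L) (hs : s ≠ 0) :
    1 / 2 * deriv (truncatedProfile ζ L) s ^ 2 ≤ (Real.sqrt 2 + C) ^ 2 * Wpot (qprof s) := by
  have hdiff : Differentiable ℝ ζ := hζ.1.differentiable (by simp)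
  obtain ⟨z0, z1⟩ := hζ.2.2.1 (2 * s / L)
  have hq := qprof_sq_le_one s
  have hw : 0 ≤ 1 - qprof s ^ 2 := by linarith
  have hC0 : 0 ≤ C := (norm_nonneg _).trans (hC 0)
  have hL2 : |2 / L| ≤ 1 := by
    rw [abs_of_nonneg (by positivity)]
    exact (div_le_one (by linarith)).2 hL
  have hb : |deriv (truncatedProfile ζ L) s| ≤ (Real.sqrt 2 + C) * (1 - qprof s ^ 2) := by
    rw [(hasDerivAt_truncatedProfile hdiff L hs).deriv]
    have h1 : |ζ (2 * s / L) * (Real.sqrt 2 * (1 - qprof s ^ 2))| ≤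
        Real.sqrt 2 * (1 - qprof s ^ 2) := by
      rw [abs_of_nonneg (by positivity)]
      exact mul_le_of_le_one_left (by positivity) z1
    have h2 : |deriv ζ (2 * s / L) * (2 / L) * (qprof s - Real.sign s)| ≤
        C * 1 * (1 - qprof s ^ 2) := by
      rw [abs_mul, abs_mul]
      exact mul_le_mul (mul_le_mul (hC _) hL2 (abs_nonneg _) hC0) (abs_qprof_sub_sign_le hs)
        (abs_nonneg _) (by positivity)
    linarith [abs_add_le (ζ (2 * s / L) * (Real.sqrt 2 * (1 - qprof s ^ 2)))
      (deriv ζ (2 * s / L) * (2 / L) * (qprof s - Real.sign s))]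
  have hsq := pow_le_pow_left₀ (abs_nonneg _) hb 2
  rw [sq_abs, mul_pow] at hsq
  rw [Wpot]
  nlinarith [sq_nonneg (deriv (truncatedProfile ζ L) s)]

theorem tendsto_gradient_energy {ζ : ℝ → ℝ} (hζ : IsCutoff ζ) :
    Tendsto (fun L : ℝ => ∫ s in (-L)..L, 1 / 2 * deriv (truncatedProfile ζ L) s ^ 2) atTop
      (𝓝 (cZero / 2)) := by
  obtain ⟨C, hC⟩ := hζ.2.1.deriv.exists_bound_of_continuous (hζ.1.continuous_deriv (by simp))
  rw [← integral_Wpot_qprof]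
  refine tendsto_intervalIntegral_neg_self_of_dominated
    (bound := fun s => (Real.sqrt 2 + C) ^ 2 * Wpot (qprof s))
    (fun L => ((measurable_deriv _).pow_const 2).const_mul _)
    (integrable_Wpot_qprof.const_mul _) ?_ fun s => ?_
  · filter_upwards [eventually_ge_atTop 2] with L hL
    filter_upwards [Measure.ae_ne volume (0 : ℝ)] with s hs
    rw [Real.norm_of_nonneg (by positivity)]
    exact half_sq_deriv_truncatedProfile_le hζ hC hL hs
  · filter_upwards [eventually_gt_atTop (2 * |s|)] with L hL
    rw [deriv_truncatedProfile_eq hζ hL, mul_pow, Real.sq_sqrt (by norm_num), Wpot]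
    ring

theorem tendsto_potential_energy {ζ : ℝ → ℝ} (hζ : IsCutoff ζ) :
    Tendsto (fun L : ℝ => ∫ s in (-L)..L, Wpot (truncatedProfile ζ L s)) atTop
      (𝓝 (cZero / 2)) := by
  have hW : Measurable Wpot := by unfold Wpot; fun_prop
  rw [← integral_Wpot_qprof]
  refine tendsto_intervalIntegral_neg_self_of_dominated
    (fun L => hW.comp (measurable_truncatedProfile hζ.1.continuous L))
    integrable_Wpot_qprof (Eventually.of_forall fun L => ?_) fun s => ?_
  · filter_upwards [Measure.ae_ne volume (0 : ℝ)] with s hs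
    rw [Real.norm_of_nonneg (Wpot_nonneg _)]
    exact Wpot_truncatedProfile_le hζ L hs
  · filter_upwards [eventually_gt_atTop (2 * |s|)] with L hL
    rw [truncatedProfile_eq_qprof hζ hL]

theorem tendsto_mul_abs_log_atTop {lam : ℝ} (hlam : 0 < lam) :
    Tendsto (fun ε : ℝ => lam * |Real.log ε|) (𝓝[>] 0) atTop :=
  (tendsto_abs_atBot_atTop.comp Real.tendsto_log_nhdsGT_zero).const_mul_atTop hlam

theorem deltaE_div (lam : ℝ) {ε : ℝ} (hε : 0 < ε) :
    deltaE lam ε / ε = lam * |Real.log ε| := by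
  rw [deltaE]
  field_simp

theorem deriv_qE (ζ : ℝ → ℝ) (lam : ℝ) {ε : ℝ} (hε : 0 < ε) (t : ℝ) :
    deriv (qE ζ lam ε) t =
      ε⁻¹ * deriv (truncatedProfile ζ (lam * |Real.log ε|)) (t / ε) := by
  have hfun : qE ζ lam ε = fun t => truncatedProfile ζ (lam * |Real.log ε|) (ε⁻¹ * t) := by
    funext t
    rw [qE_eq_truncatedProfile ζ lam hε, div_eq_inv_mul]
  rw [hfun, deriv_comp_mul_left, smul_eq_mul, div_eq_inv_mul]

/-- Lemma 3.6 (first part): for every cutoff `ζ` and every `λ > 1`,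
`∫_{-δ_ε}^{δ_ε} (ε/2) q_ε'(t)² dt → c₀/2` and
`∫_{-δ_ε}^{δ_ε} (1/ε) W(q_ε(t)) dt → c₀/2` as `ε → 0⁺`. -/
theorem stmt1 (ζ : ℝ → ℝ) (hζ : IsCutoff ζ) (lam : ℝ) (hlam : 1 < lam) :
    Tendsto (fun ε : ℝ =>
        ∫ t in (-deltaE lam ε)..(deltaE lam ε), (ε / 2) * (deriv (qE ζ lam ε) t) ^ 2)
      (𝓝[>] (0:ℝ)) (𝓝 (cZero / 2)) ∧
    Tendsto (fun ε : ℝ =>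
        ∫ t in (-deltaE lam ε)..(deltaE lam ε), (1 / ε) * Wpot (qE ζ lam ε t))
      (𝓝[>] (0:ℝ)) (𝓝 (cZero / 2)) := by
  refine ⟨?_, ?_⟩
  · refine ((tendsto_gradient_energy hζ).comp
      (tendsto_mul_abs_log_atTop (by linarith : 0 < lam))).congr' ?_
    filter_upwards [self_mem_nhdsWithin] with ε hε
    replace hε : 0 < ε := hε
    have h := inv_smul_integral_comp_div (a := -deltaE lam ε) (b := deltaE lam ε)
      (fun s => 1 / 2 * deriv (truncatedProfile ζ (lam * |Real.log ε|)) s ^ 2) ε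
    rw [neg_div, deltaE_div lam hε] at h
    rw [Function.comp_apply, ← h, smul_eq_mul, ← intervalIntegral.integral_const_mul]
    congr 1
    funext t
    rw [deriv_qE ζ lam hε]
    field_simp
  · refine ((tendsto_potential_energy hζ).comp
      (tendsto_mul_abs_log_atTop (by linarith : 0 < lam))).congr' ?_
    filter_upwards [self_mem_nhdsWithin] with ε hε
    replace hε : 0 < ε := hε
    have h := inv_smul_integral_comp_div (a := -deltaE lam ε) (b := deltaE lam ε)
      (fun s => Wpot (truncatedProfile ζ (lam * |Real.log ε|) s)) ε
    rw [neg_div, deltaE_div lam hε] at h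
    rw [Function.comp_apply, ← h, smul_eq_mul, ← intervalIntegral.integral_const_mul]
    congr 1
    funext t
    rw [qE_eq_truncatedProfile ζ lam hε, one_div]
end

section
/- Let L_i = {s·γ_i'(0) : s ≥ 0} be the half tangent line of Γ_i at x₀ translated to the origin, for 1 ≤ i ≤ N. Then: (a) for every continuous compactly supported function ζ : ℝ² → ℝ, lim_{ρ→0⁺} (1/ρ) ∫_{⋃_{i=1}^N Γ_i} ζ((y − x₀)/ρ) dH¹(y) = Σ_{i=1}^N ∫_{L_i} ζ dH¹; and (b) lim_{ρ→0⁺} H¹( (⋃_{i=1}^N Γ_i) ∩ B_ρ(x₀) ) / (2ρ) = N/2. -/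
open MeasureTheory Filter Set Topology

/-- A map that contracts distances on `A` by at most a factor `K` contracts the Hausdorff measure
of `A` by at most `K ^ d`. -/
theorem hausdorffMeasure_le_of_dist_le {X Y : Type*} [MetricSpace X] [MetricSpace Y]
    [MeasurableSpace X] [BorelSpace X] [MeasurableSpace Y] [BorelSpace Y] {f : X → Y} {A : Set X}
    {K : NNReal} {d : ℝ} (hd : 0 ≤ d)
    (h : ∀ s ∈ A, ∀ t ∈ A, dist s t ≤ K * dist (f s) (f t)) :
    μH[d] A ≤ (K : ENNReal) ^ d * μH[d] (f '' A) := by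
  rcases A.eq_empty_or_nonempty with rfl | ⟨a, -⟩
  · simp
  have : Nonempty X := ⟨a⟩
  have hinj : InjOn f A := fun s hs t ht hst => by
    have := h s hs t ht
    rw [hst, dist_self, mul_zero] at this
    exact dist_le_zero.1 this
  have hinv : LeftInvOn (Function.invFunOn f A) f A := hinj.leftInvOn_invFunOn
  have hlip : LipschitzOnWith K (Function.invFunOn f A) (f '' A) := by
    refine LipschitzOnWith.of_dist_le_mul ?_
    rintro _ ⟨s, hs, rfl⟩ _ ⟨t, ht, rfl⟩
    rw [hinv hs, hinv ht]
    exact h s hs t ht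
  have := hlip.hausdorffMeasure_image_le hd
  rwa [hinv.image_image] at this

/-- A function which is continuous on a closed interval agrees there with a continuous function. -/
theorem exists_continuous_eqOn_Icc {E : Type*} [TopologicalSpace E] {γ : ℝ → E} {a b : ℝ}
    (hγ : ContinuousOn γ (Icc a b)) : ∃ g, Continuous g ∧ EqOn g γ (Icc a b) := by
  rcases lt_or_ge b a with h | h
  · exact ⟨fun _ => γ a, continuous_const, by simp [Icc_eq_empty_of_lt h]⟩
  · exact ⟨IccExtend h ((Icc a b).domRestrict γ), hγ.domRestrict.Icc_extend',
      fun t ht => by rw [IccExtend_of_mem h _ ht, domRestrict_apply]⟩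

section Curve

variable {E : Type*} [NormedAddCommGroup E] [NormedSpace ℝ E] {γ γ' : ℝ → E} {L : ℝ}

/-- A unit-speed curve almost preserves small distances. -/
theorem exists_forall_dist_le_mul_dist
    (hderiv : ∀ t ∈ Icc 0 L, HasDerivWithinAt γ (γ' t) (Icc 0 L) t)
    (hcont : ContinuousOn γ' (Icc 0 L)) (hunit : ∀ t ∈ Icc 0 L, ‖γ' t‖ = 1)
    {K : ℝ} (hK : 1 < K) :
    ∃ δ > 0, ∀ s ∈ Icc 0 L, ∀ t ∈ Icc 0 L, dist s t < δ → dist s t ≤ K * dist (γ s) (γ t) := by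
  have hK0 : 0 < K := zero_lt_one.trans hK
  have hε : 0 < 1 - K⁻¹ := sub_pos.2 (inv_lt_one_of_one_lt₀ hK)
  have hu := isCompact_Icc.uniformContinuousOn_of_continuous hcont
  obtain ⟨δ, hδ, h⟩ := Metric.uniformContinuousOn_iff.1 hu _ hε
  refine ⟨δ, hδ, fun s hs t ht hst => ?_⟩
  have hsub : uIcc s t ⊆ Icc 0 L := ordConnected_Icc.uIcc_subset hs ht
  have hd : ∀ x ∈ uIcc s t,
      HasDerivWithinAt (fun x => γ x - x • γ' s) (γ' x - γ' s) (uIcc s t) x := fun x hx => by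
    simpa [Pi.sub_def] using ((hderiv x (hsub hx)).mono hsub).sub
      ((hasDerivWithinAt_id x (uIcc s t)).smul_const (γ' s))
  have hb : ∀ x ∈ uIcc s t, ‖γ' x - γ' s‖ ≤ 1 - K⁻¹ := fun x hx => by
    rw [← dist_eq_norm]
    refine (h x (hsub hx) s hs (lt_of_le_of_lt ?_ hst)).le
    rw [dist_comm x s, Real.dist_eq, Real.dist_eq, abs_sub_comm, abs_sub_comm s t]
    exact abs_sub_left_of_mem_uIcc hx
  have key := (convex_uIcc s t).norm_image_sub_le_of_norm_hasDerivWithin_le hd hb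
    left_mem_uIcc right_mem_uIcc
  have e : (γ t - t • γ' s) - (γ s - s • γ' s) = (γ t - γ s) - (t - s) • γ' s := by
    module
  have h1 : ‖(t - s) • γ' s‖ = dist s t := by
    rw [norm_smul, hunit s hs, mul_one, dist_comm, Real.dist_eq, Real.norm_eq_abs]
  have h2 : ‖t - s‖ = dist s t := by rw [dist_comm, dist_eq_norm]
  have h3 : ‖γ t - γ s‖ = dist (γ s) (γ t) := by rw [dist_comm, dist_eq_norm]
  have h4 := norm_sub_norm_le ((t - s) • γ' s) (γ t - γ s)
  rw [norm_sub_rev ((t - s) • γ' s), h1, h3] at h4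
  rw [e, h2] at key
  have h5 : K⁻¹ * dist s t ≤ dist (γ s) (γ t) := by linarith
  rwa [inv_mul_le_iff₀ hK0] at h5

/-- An injective unit-speed curve leaves its starting point at least linearly. -/
theorem exists_mul_le_norm_sub (hL : 0 < L)
    (hderiv : ∀ t ∈ Icc 0 L, HasDerivWithinAt γ (γ' t) (Icc 0 L) t)
    (hcont : ContinuousOn γ' (Icc 0 L)) (hunit : ∀ t ∈ Icc 0 L, ‖γ' t‖ = 1)
    (hinj : InjOn γ (Icc 0 L)) :
    ∃ c > 0, ∀ t ∈ Icc 0 L, c * t ≤ ‖γ t - γ 0‖ := by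
  obtain ⟨δ, hδ, h⟩ := exists_forall_dist_le_mul_dist hderiv hcont hunit one_lt_two
  have h0 : (0 : ℝ) ∈ Icc 0 L := left_mem_Icc.2 hL.le
  have hγ : ContinuousOn γ (Icc 0 L) := fun t ht => (hderiv t ht).continuousWithinAt
  have hsub : Icc (min δ L) L ⊆ Icc 0 L := Icc_subset_Icc_left (lt_min hδ hL).le
  obtain ⟨a, ha, hmin⟩ := isCompact_Icc.exists_isMinOn (nonempty_Icc.2 (min_le_right δ L))
    ((hγ.mono hsub).sub continuousOn_const).norm (f := fun t => ‖γ t - γ 0‖)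
  have ha0 : 0 < ‖γ a - γ 0‖ := by
    rw [norm_pos_iff, sub_ne_zero]
    intro hcon
    have := hinj (hsub ha) h0 hcon
    rw [this] at ha
    exact absurd ha.1 (not_le.2 (lt_min hδ hL))
  refine ⟨min (1 / 2) (‖γ a - γ 0‖ / L), by positivity, fun t ht => ?_⟩
  rcases lt_or_ge t (min δ L) with htδ | htδ
  · have h1 := h t ht 0 h0 (by
      rw [Real.dist_eq, sub_zero, abs_of_nonneg ht.1]; exact htδ.trans_le (min_le_left _ _))
    rw [Real.dist_eq, sub_zero, abs_of_nonneg ht.1, dist_eq_norm] at h1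
    have := mul_le_mul_of_nonneg_right (min_le_left (1 / 2) (‖γ a - γ 0‖ / L)) ht.1
    linarith
  · calc _ ≤ ‖γ a - γ 0‖ / L * L := mul_le_mul (min_le_right _ _) ht.2 ht.1 (by positivity)
      _ = ‖γ a - γ 0‖ := by field_simp
      _ ≤ _ := hmin ⟨htδ, ht.2⟩

variable [MeasurableSpace E] [BorelSpace E]

/-- An injective unit-speed curve preserves one-dimensional measure. -/
theorem hausdorffMeasure_image_of_unit_speed
    (hderiv : ∀ t ∈ Icc 0 L, HasDerivWithinAt γ (γ' t) (Icc 0 L) t)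
    (hcont : ContinuousOn γ' (Icc 0 L)) (hunit : ∀ t ∈ Icc 0 L, ‖γ' t‖ = 1)
    (hinj : InjOn γ (Icc 0 L)) {A : Set ℝ} (hA : MeasurableSet A) (hAL : A ⊆ Icc 0 L) :
    μH[1] (γ '' A) = volume A := by
  have hγ : ContinuousOn γ (Icc 0 L) := fun t ht => (hderiv t ht).continuousWithinAt
  apply le_antisymm
  · have hlip : LipschitzOnWith 1 γ (Icc 0 L) :=
      (convex_Icc 0 L).lipschitzOnWith_of_nnnorm_hasDerivWithin_le hderiv
        fun t ht => by rw [← NNReal.coe_le_coe]; exact (hunit t ht).le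
    simpa [hausdorffMeasure_real] using
      (hlip.mono hAL).hausdorffMeasure_image_le zero_le_one
  · have main : ∀ K : NNReal, 1 < K → volume A ≤ K * μH[1] (γ '' A) := by
      intro K hK
      obtain ⟨δ, hδ, h⟩ :=
        exists_forall_dist_le_mul_dist hderiv hcont hunit (NNReal.coe_lt_coe.2 hK)
      set B : ℤ → Set ℝ := fun n => A ∩ Ico (n • δ) ((n + 1) • δ) with hB
      have hBA : ∀ n, B n ⊆ A := fun n => inter_subset_left
      have hBm : ∀ n, MeasurableSet (B n) := fun n => hA.inter measurableSet_Ico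
      have hBd : Pairwise (Function.onFun Disjoint B) := fun m n hmn =>
        (pairwise_disjoint_Ico_zsmul δ hmn).mono inter_subset_right inter_subset_right
      have hU : A = ⋃ n, B n := by
        rw [hB, ← inter_iUnion, iUnion_Ico_zsmul hδ, inter_univ]
      have hpiece : ∀ n, volume (B n) ≤ K * μH[1] (γ '' B n) := by
        intro n
        rw [← hausdorffMeasure_real]
        refine (hausdorffMeasure_le_of_dist_le (f := γ) (K := K) zero_le_one ?_).trans_eq
          (by rw [ENNReal.rpow_one])
        intro s hs t ht
        refine h s (hAL hs.1) t (hAL ht.1) ?_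
        have h1 := hs.2
        have h2 := ht.2
        simp only [zsmul_eq_mul, Int.cast_add, Int.cast_one, mem_Ico] at h1 h2
        rw [Real.dist_eq, abs_lt]
        constructor <;> linarith [h1.1, h1.2, h2.1, h2.2]
      calc volume A = ∑' n, volume (B n) := by
            conv_lhs => rw [hU]
            exact measure_iUnion hBd hBm
        _ ≤ ∑' n, K * μH[1] (γ '' B n) := ENNReal.tsum_le_tsum hpiece
        _ = K * ∑' n, μH[1] (γ '' B n) := ENNReal.tsum_mul_left
        _ = K * μH[1] (γ '' A) := by
            conv_rhs => rw [hU, image_iUnion]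
            rw [measure_iUnion]
            · exact fun m n hmn =>
                disjoint_iff_inter_eq_empty.2 (by
                  rw [← (hinj.mono hAL).image_inter (hBA m) (hBA n),
                    (hBd hmn).inter_eq, image_empty])
            · exact fun n => (hBm n).image_of_continuousOn_injOn
                (hγ.mono ((hBA n).trans hAL)) (hinj.mono ((hBA n).trans hAL))
    have hlim : Tendsto (fun K : NNReal => (K : ENNReal) * μH[1] (γ '' A)) (𝓝[>] 1)
        (𝓝 (((1 : NNReal) : ENNReal) * μH[1] (γ '' A))) :=
      ENNReal.Tendsto.mul_const
        ((ENNReal.continuous_coe.tendsto 1).mono_left nhdsWithin_le_nhds) (Or.inl (by simp))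
    rw [ENNReal.coe_one, one_mul] at hlim
    exact ge_of_tendsto hlim (by filter_upwards [self_mem_nhdsWithin] with K hK using main K hK)

/-- The length measure on an injective unit-speed curve is the image of Lebesgue measure. -/
theorem map_volume_of_unit_speed
    (hderiv : ∀ t ∈ Icc 0 L, HasDerivWithinAt γ (γ' t) (Icc 0 L) t)
    (hcont : ContinuousOn γ' (Icc 0 L)) (hunit : ∀ t ∈ Icc 0 L, ‖γ' t‖ = 1)
    (hinj : InjOn γ (Icc 0 L)) :
    Measure.map γ (volume.restrict (Icc 0 L)) = (μH[1]).restrict (γ '' Icc 0 L) := by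
  have hγ : ContinuousOn γ (Icc 0 L) := fun t ht => (hderiv t ht).continuousWithinAt
  have hm : AEMeasurable γ (volume.restrict (Icc 0 L)) := hγ.aemeasurable measurableSet_Icc
  ext S hS
  obtain ⟨T, hT, hTS⟩ : ∃ T, MeasurableSet T ∧ γ ⁻¹' S ∩ Icc 0 L = T ∩ Icc 0 L := by
    obtain ⟨g, hg, hgγ⟩ := exists_continuous_eqOn_Icc hγ
    refine ⟨g ⁻¹' S, hg.measurable hS, ?_⟩
    ext t
    refine and_congr_left fun ht => ?_
    rw [mem_preimage, mem_preimage, hgγ ht]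
  rw [Measure.map_apply_of_aemeasurable hm hS, Measure.restrict_apply hS,
    Measure.restrict_apply' measurableSet_Icc, hTS,
    ← hausdorffMeasure_image_of_unit_speed hderiv hcont hunit hinj
      (hT.inter measurableSet_Icc) inter_subset_right, ← hTS, image_preimage_inter]

/-- Blow-up of the length measure on a unit-speed curve at its starting point. -/
theorem tendsto_blowup_of_unit_speed (hL : 0 < L)
    (hderiv : ∀ t ∈ Icc 0 L, HasDerivWithinAt γ (γ' t) (Icc 0 L) t)
    (hcont : ContinuousOn γ' (Icc 0 L)) (hunit : ∀ t ∈ Icc 0 L, ‖γ' t‖ = 1)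
    (hinj : InjOn γ (Icc 0 L)) {f : E → ℝ} (hf : Measurable f) {M R : ℝ}
    (hM : ∀ z, ‖f z‖ ≤ M) (hR : ∀ z, R < ‖z‖ → f z = 0)
    (hfc : ∀ᵐ s ∂volume.restrict (Ioi (0 : ℝ)), ContinuousAt f (s • γ' 0)) :
    Tendsto (fun ρ : ℝ => (1 / ρ) * ∫ y in γ '' Icc 0 L, f (ρ⁻¹ • (y - γ 0)) ∂μH[1])
      (𝓝[>] 0) (𝓝 (∫ s in Ioi (0 : ℝ), f (s • γ' 0))) := by
  have hγ : ContinuousOn γ (Icc 0 L) := fun t ht => (hderiv t ht).continuousWithinAt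
  have h0 : (0 : ℝ) ∈ Icc 0 L := left_mem_Icc.2 hL.le
  obtain ⟨c, hc, hgrow⟩ := exists_mul_le_norm_sub hL hderiv hcont hunit hinj
  set g : ℝ → ℝ → ℝ := fun ρ => (Icc 0 L).indicator fun t => f (ρ⁻¹ • (γ t - γ 0)) with hg
  have hfm : ∀ ρ : ℝ, Measurable fun y => f (ρ⁻¹ • (y - γ 0)) := fun ρ =>
    hf.comp (by fun_prop : Continuous fun y : E => ρ⁻¹ • (y - γ 0)).measurable
  have hgm : ∀ ρ, Measurable (g ρ) := by
    intro ρ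
    obtain ⟨γc, hγc, heq⟩ := exists_continuous_eqOn_Icc hγ
    have : g ρ = (Icc 0 L).indicator fun t => f (ρ⁻¹ • (γc t - γ 0)) :=
      indicator_congr fun t ht => by rw [heq ht]
    rw [this]
    exact ((hfm ρ).comp hγc.measurable).indicator measurableSet_Icc
  have hint : ∀ ρ : ℝ, 0 < ρ →
      (1 / ρ) * ∫ y in γ '' Icc 0 L, f (ρ⁻¹ • (y - γ 0)) ∂μH[1]
        = ∫ s in Ioi (0 : ℝ), g ρ (ρ * s) := by
    intro ρ hρ
    have hmap := map_volume_of_unit_speed hderiv hcont hunit hinj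
    have hae : AEMeasurable γ (volume.restrict (Icc 0 L)) := hγ.aemeasurable measurableSet_Icc
    rw [integral_comp_mul_left_Ioi _ _ hρ, mul_zero, smul_eq_mul, one_div, ← hmap,
      integral_map hae (hfm ρ).aestronglyMeasurable, ← integral_Ici_eq_integral_Ioi, hg,
      setIntegral_indicator measurableSet_Icc, inter_eq_self_of_subset_right Icc_subset_Ici_self]
  have hgoal : Tendsto (fun ρ : ℝ => ∫ s in Ioi (0 : ℝ), g ρ (ρ * s)) (𝓝[>] 0)
      (𝓝 (∫ s in Ioi (0 : ℝ), f (s • γ' 0))) := by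
    refine tendsto_integral_filter_of_dominated_convergence
      ((Icc 0 (R / c)).indicator fun _ => M) ?_ ?_ ?_ ?_
    · exact Eventually.of_forall fun ρ =>
        ((hgm ρ).comp (measurable_const_mul ρ)).aestronglyMeasurable
    · filter_upwards [self_mem_nhdsWithin] with ρ (hρ : 0 < ρ)
      filter_upwards [ae_restrict_mem measurableSet_Ioi] with s (hs : 0 < s)
      have hM0 : 0 ≤ M := (norm_nonneg _).trans (hM 0)
      by_cases hsL : ρ * s ∈ Icc 0 L
      · by_cases hsR : s ≤ R / c
        · simp only [hg]
          rw [indicator_of_mem hsL, indicator_of_mem (mem_Icc.2 ⟨hs.le, hsR⟩)]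
          exact hM _
        · simp only [hg]
          rw [indicator_of_mem hsL, hR, norm_zero]
          · exact indicator_nonneg (fun _ _ => hM0) _
          · rw [norm_smul, norm_inv, Real.norm_of_nonneg hρ.le]
            rw [not_le, div_lt_iff₀ hc] at hsR
            calc R < s * c := hsR
              _ = ρ⁻¹ * (c * (ρ * s)) := by field_simp
              _ ≤ _ := mul_le_mul_of_nonneg_left (hgrow _ hsL) (by positivity)
      · simp only [hg]
        rw [indicator_of_notMem hsL, norm_zero]
        exact indicator_nonneg (fun _ _ => hM0) _
    · refine Integrable.restrict ?_
      rw [integrable_indicator_iff measurableSet_Icc]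
      exact integrableOn_const measure_Icc_lt_top.ne
    · filter_upwards [hfc, ae_restrict_mem measurableSet_Ioi] with s hs (hs0 : 0 < s)
      have hlin : Tendsto (fun ρ : ℝ => ρ * s) (𝓝[>] 0) (𝓝 0) := by
        have : Tendsto (fun ρ : ℝ => ρ * s) (𝓝 0) (𝓝 (0 * s)) :=
          (continuous_mul_const s).tendsto 0
        rw [zero_mul] at this
        exact this.mono_left nhdsWithin_le_nhds
      have hmem : ∀ᶠ ρ : ℝ in 𝓝[>] 0, ρ * s ∈ Icc 0 L \ {0} := by
        filter_upwards [self_mem_nhdsWithin, hlin.eventually_lt_const hL] with ρ (hρ : 0 < ρ) h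
        exact ⟨⟨by positivity, h.le⟩, (mul_pos hρ hs0).ne'⟩
      have hslope := (hasDerivWithinAt_iff_tendsto_slope.1 (hderiv 0 h0)).comp
        (tendsto_nhdsWithin_iff.2 ⟨hlin, hmem⟩)
      have hpt : Tendsto (fun ρ : ℝ => ρ⁻¹ • (γ (ρ * s) - γ 0)) (𝓝[>] 0) (𝓝 (s • γ' 0)) := by
        refine (hslope.const_smul s).congr' ?_
        filter_upwards [self_mem_nhdsWithin] with ρ (hρ : 0 < ρ)
        rw [Function.comp_apply, slope_def_module, sub_zero, smul_smul]
        congr 1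
        field_simp
      refine (hs.tendsto.comp hpt).congr' ?_
      filter_upwards [hmem] with ρ hρ
      simp only [hg]
      rw [indicator_of_mem hρ.1, Function.comp_apply]
  refine hgoal.congr' ?_
  filter_upwards [self_mem_nhdsWithin] with ρ hρ using (hint ρ hρ).symm

/-- Integration over a half line with respect to length. -/
theorem setIntegral_halfLine_hausdorffMeasure {v : E} (hv : ‖v‖ = 1) (f : E → ℝ) :
    ∫ y in {z : E | ∃ s : ℝ, 0 ≤ s ∧ z = s • v}, f y ∂μH[1]
      = ∫ s in Ioi (0 : ℝ), f (s • v) := by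
  have hiso : Isometry fun s : ℝ => s • v :=
    Isometry.of_dist_eq fun s t => by
      rw [dist_eq_norm, dist_eq_norm, ← sub_smul, norm_smul, hv, mul_one]
  have hemb := hiso.isClosedEmbedding.measurableEmbedding
  have hset : {z : E | ∃ s : ℝ, 0 ≤ s ∧ z = s • v} = (fun s : ℝ => s • v) '' Ici 0 := by
    ext z
    simp only [mem_ofPred_eq, mem_image, mem_Ici, eq_comm]
  have hmap := hiso.map_hausdorffMeasure (d := 1) (Or.inl zero_le_one)
  rw [hausdorffMeasure_real] at hmap
  have := hemb.setIntegral_map (μ := volume) f ((fun s : ℝ => s • v) '' Ici 0)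
  rw [hmap, Measure.restrict_restrict (hemb.measurableSet_image.2 measurableSet_Ici),
    inter_eq_self_of_subset_left (image_subset_range _ _),
    preimage_image_eq _ hiso.injective, integral_Ici_eq_integral_Ioi] at this
  rw [hset, this]

end Curve

/-- Blow-up of the length measure on a finite union of unit-speed curves which meet only at their
common starting point. -/
theorem tendsto_blowup_iUnion_of_unit_speed {E : Type*} [NormedAddCommGroup E] [NormedSpace ℝ E]
    [MeasurableSpace E] [BorelSpace E] {ι : Type*} [Fintype ι] {x₀ : E} {L : ι → ℝ}
    (hL : ∀ i, 0 < L i) {γ γ' : ι → ℝ → E}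
    (hderiv : ∀ i, ∀ t ∈ Icc 0 (L i), HasDerivWithinAt (γ i) (γ' i t) (Icc 0 (L i)) t)
    (hcont : ∀ i, ContinuousOn (γ' i) (Icc 0 (L i)))
    (hunit : ∀ i, ∀ t ∈ Icc 0 (L i), ‖γ' i t‖ = 1)
    (hinj : ∀ i, InjOn (γ i) (Icc 0 (L i))) (hstart : ∀ i, γ i 0 = x₀)
    (hmeet : ∀ i j, i ≠ j → (γ i '' Icc 0 (L i)) ∩ (γ j '' Icc 0 (L j)) = {x₀})
    {f : E → ℝ} (hf : Measurable f) {M R : ℝ}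
    (hM : ∀ z, ‖f z‖ ≤ M) (hR : ∀ z, R < ‖z‖ → f z = 0)
    (hfc : ∀ i, ∀ᵐ s ∂volume.restrict (Ioi (0 : ℝ)), ContinuousAt f (s • γ' i 0)) :
    Tendsto (fun ρ : ℝ => (1 / ρ) * ∫ y in ⋃ i, γ i '' Icc 0 (L i), f (ρ⁻¹ • (y - x₀)) ∂μH[1])
      (𝓝[>] 0) (𝓝 (∑ i, ∫ s in Ioi (0 : ℝ), f (s • γ' i 0))) := by
  have hlim := tendsto_finsetSum Finset.univ fun i _ =>
    tendsto_blowup_of_unit_speed (hL i) (hderiv i) (hcont i) (hunit i) (hinj i) hf hM hR (hfc i)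
  simp only [hstart] at hlim
  refine hlim.congr fun ρ => ?_
  have hmeas : ∀ i, MeasurableSet (γ i '' Icc 0 (L i)) := fun i =>
    measurableSet_Icc.image_of_continuousOn_injOn
      (fun t ht => (hderiv i t ht).continuousWithinAt) (hinj i)
  have := Measure.nullSingletonClass_hausdorff E (d := 1) one_pos
  have hdisj : Pairwise (Function.onFun (AEDisjoint (μH[1] : Measure E))
      fun i => γ i '' Icc 0 (L i)) := fun i j hij => by
    simp only [Function.onFun, AEDisjoint, hmeet i j hij, measure_singleton]
  have hfin : ∀ i, μH[1] (γ i '' Icc 0 (L i)) ≠ ⊤ := fun i => by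
    rw [hausdorffMeasure_image_of_unit_speed (hderiv i) (hcont i) (hunit i) (hinj i)
      measurableSet_Icc subset_rfl]
    exact measure_Icc_lt_top.ne
  have hint : IntegrableOn (fun y => f (ρ⁻¹ • (y - x₀))) (⋃ i, γ i '' Icc 0 (L i)) μH[1] := by
    rw [integrableOn_finite_iUnion]
    intro i
    have : IsFiniteMeasure ((μH[1] : Measure E).restrict (γ i '' Icc 0 (L i))) :=
      isFiniteMeasure_restrict.2 (hfin i)
    exact Integrable.of_bound (hf.comp (by fun_prop :
      Continuous fun y : E => ρ⁻¹ • (y - x₀)).measurable).aestronglyMeasurable M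
      (Eventually.of_forall fun y => hM _)
  rw [integral_iUnion_ae (fun i => (hmeas i).nullMeasurableSet) hdisj hint, tsum_fintype,
    Finset.mul_sum]

/-- Lemma 2.5(iii): blow-up of `H¹ ⌊ (⋃ᵢ Γᵢ)` at the common endpoint `x₀`.
(a) For every continuous compactly supported `ζ : ℝ² → ℝ`,
`(1/ρ) ∫_{⋃ᵢ Γᵢ} ζ((y - x₀)/ρ) dH¹(y) → Σᵢ ∫_{Lᵢ} ζ dH¹` as `ρ → 0⁺`, where
`Lᵢ = ℝ⁺·γᵢ'(0)`; (b) `H¹((⋃ᵢ Γᵢ) ∩ B_ρ(x₀))/(2ρ) → N/2`. -/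
theorem stmt9 (N : ℕ) (hN : 1 ≤ N) (x₀ : EuclideanSpace ℝ (Fin 2))
    (L : Fin N → ℝ) (hL : ∀ i, 0 < L i)
    (γ : Fin N → ℝ → EuclideanSpace ℝ (Fin 2))
    (hsmooth : ∀ i, ContDiffOn ℝ 2 (γ i) (Set.Icc 0 (L i)))
    (hinj : ∀ i, Set.InjOn (γ i) (Set.Icc 0 (L i)))
    (harc : ∀ i, ∀ t ∈ Set.Icc (0:ℝ) (L i), ‖derivWithin (γ i) (Set.Icc 0 (L i)) t‖ = 1)
    (hstart : ∀ i, γ i 0 = x₀)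
    (hmeet : ∀ i j, i ≠ j →
      (γ i '' Set.Icc 0 (L i)) ∩ (γ j '' Set.Icc 0 (L j)) = {x₀}) :
    (∀ ζ : EuclideanSpace ℝ (Fin 2) → ℝ, Continuous ζ → HasCompactSupport ζ →
      Tendsto (fun ρ : ℝ =>
          (1 / ρ) * ∫ y in ⋃ i, γ i '' Set.Icc 0 (L i), ζ (ρ⁻¹ • (y - x₀)) ∂(μH[1]))
        (𝓝[>] (0:ℝ))
        (𝓝 (∑ i : Fin N, ∫ y in {z : EuclideanSpace ℝ (Fin 2) |
              ∃ s : ℝ, 0 ≤ s ∧ z = s • derivWithin (γ i) (Set.Icc 0 (L i)) 0},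
              ζ y ∂(μH[1])))) ∧
    Tendsto (fun ρ : ℝ =>
        (μH[1] ((⋃ i, γ i '' Set.Icc 0 (L i)) ∩ Metric.ball x₀ ρ)).toReal / (2 * ρ))
      (𝓝[>] (0:ℝ)) (𝓝 ((N : ℝ) / 2)) := by
  have h0 : ∀ i, (0 : ℝ) ∈ Icc 0 (L i) := fun i => left_mem_Icc.2 (hL i).le
  have hderiv : ∀ i, ∀ t ∈ Icc 0 (L i),
      HasDerivWithinAt (γ i) (derivWithin (γ i) (Icc 0 (L i)) t) (Icc 0 (L i)) t := fun i t ht =>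
    ((hsmooth i).differentiableOn (by norm_num) t ht).hasDerivWithinAt
  have hcont : ∀ i, ContinuousOn (derivWithin (γ i) (Icc 0 (L i))) (Icc 0 (L i)) := fun i =>
    (hsmooth i).continuousOn_derivWithin (uniqueDiffOn_Icc (hL i)) (by norm_num)
  constructor
  · intro ζ hζ hsupp
    simp only [fun i => setIntegral_halfLine_hausdorffMeasure (harc i 0 (h0 i)) ζ]
    obtain ⟨M, hM⟩ := hζ.bounded_above_of_compact_support hsupp
    obtain ⟨R, hR⟩ := hsupp.isCompact.isBounded.subset_closedBall 0
    refine tendsto_blowup_iUnion_of_unit_speed hL hderiv hcont harc hinj hstart hmeet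
      hζ.measurable hM (R := R) (fun z hz => ?_)
      fun i => Eventually.of_forall fun s => hζ.continuousAt
    refine image_eq_zero_of_notMem_tsupport fun hmem => ?_
    exact not_le.2 hz (mem_closedBall_zero_iff.1 (hR hmem))
  · set f : EuclideanSpace ℝ (Fin 2) → ℝ := (Metric.ball 0 1).indicator 1 with hf
    have hnorm : ∀ i, ∀ s : ℝ, 0 < s → ‖s • derivWithin (γ i) (Icc 0 (L i)) 0‖ = s :=
      fun i s hs => by
        rw [norm_smul, harc i 0 (h0 i), mul_one, Real.norm_of_nonneg hs.le]
    have hlim := tendsto_blowup_iUnion_of_unit_speed hL hderiv hcont harc hinj hstart hmeet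
      (f := f) (M := 1) (R := 1) (measurable_one.indicator measurableSet_ball)
      (fun z => (norm_indicator_le_norm_self _ _).trans (by simp))
      (fun z hz => indicator_of_notMem (by simpa using hz.le) _)
      (fun i => by
        filter_upwards [ae_restrict_mem measurableSet_Ioi,
          ae_restrict_of_ae (compl_mem_ae_iff.2 (measure_singleton (1 : ℝ)))] with s (hs : 0 < s) h1
        have hs1 : s ≠ 1 := h1
        rcases lt_or_gt_of_ne hs1 with h | h
        · refine (continuousAt_const (y := (1 : ℝ))).congr ?_
          filter_upwards [Metric.isOpen_ball.mem_nhds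
            (mem_ball_zero_iff.2 ((hnorm i s hs).trans_lt h))] with z hz
          rw [hf, indicator_of_mem hz, Pi.one_apply]
        · refine (continuousAt_const (y := (0 : ℝ))).congr ?_
          filter_upwards [continuous_norm.continuousAt.eventually_const_lt
            (h.trans_eq (hnorm i s hs).symm)] with z hz
          rw [hf, indicator_of_notMem (by simpa using hz.le)])
    have hone : ∀ i, ∫ s in Ioi (0 : ℝ), f (s • derivWithin (γ i) (Icc 0 (L i)) 0) = 1 := by
      intro i
      have : ∀ s ∈ Ioi (0 : ℝ), f (s • derivWithin (γ i) (Icc 0 (L i)) 0)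
          = (Iio (1 : ℝ)).indicator 1 s := by
        intro s hs
        rw [hf]
        simp only [indicator, mem_ball_zero_iff, hnorm i s hs, mem_Iio, Pi.one_apply]
      rw [setIntegral_congr_fun measurableSet_Ioi this, setIntegral_indicator measurableSet_Iio,
        Ioi_inter_Iio]
      simp
    simp only [hone, Finset.sum_const, Finset.card_univ, Fintype.card_fin, nsmul_eq_mul,
      mul_one] at hlim
    refine (hlim.div_const 2).congr' ?_
    filter_upwards [self_mem_nhdsWithin] with ρ (hρ : 0 < ρ)
    have hball : (fun y => f (ρ⁻¹ • (y - x₀))) = (Metric.ball x₀ ρ).indicator 1 := by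
      ext y
      have : ρ⁻¹ • (y - x₀) ∈ Metric.ball (0 : EuclideanSpace ℝ (Fin 2)) 1
          ↔ y ∈ Metric.ball x₀ ρ := by
        rw [mem_ball_zero_iff, norm_smul, norm_inv, Real.norm_of_nonneg hρ.le,
          inv_mul_lt_iff₀ hρ, mul_one, mem_ball_iff_norm]
      classical simp only [hf, indicator_apply, this]; rfl
    rw [hball, integral_indicator_one measurableSet_ball, measureReal_def,
      Measure.restrict_apply measurableSet_ball, inter_comm]
    field_simp
end
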